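/- There is no 12×12 integer matrix M satisfying Mᵀ·G·M = G and having characteristic polynomial equal to the 13th cyclotomic polynomial Φ₁₃(X) = X¹² + X¹¹ + ⋯ + X + 1, where G is the Gram matrix of the even unimodular lattice U ⊕ U ⊕ E8 of signature (2,10). In other words, the lattice U⊕²⊕E8 admits no isometry whose characteristic polynomial is Φ₁₃. -/

import Mathlib

open Matrix
/-- Gram matrix of the hyperbolic plane `U`. -/
def latU : Matrix (Fin 2) (Fin 2) ℤ := !![0, 1; 1, 0]

/-- Gram matrix of the negative definite `E8` lattice (diagonal `-2`, entry `1` for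
vertices adjacent in the `E8` Dynkin diagram). -/
def latE8 : Matrix (Fin 8) (Fin 8) ℤ :=
  !![-2,  0,  1,  0,  0,  0,  0,  0;
      0, -2,  0,  1,  0,  0,  0,  0;
      1,  0, -2,  1,  0,  0,  0,  0;
      0,  1,  1, -2,  1,  0,  0,  0;
      0,  0,  0,  1, -2,  1,  0,  0;
      0,  0,  0,  0,  1, -2,  1,  0;
      0,  0,  0,  0,  0,  1, -2,  1;
      0,  0,  0,  0,  0,  0,  1, -2]

/-- Gram matrix of the lattice `U ⊕ U ⊕ E8` of signature `(2,10)`. -/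
def gramUUE8 : Matrix (Fin 12) (Fin 12) ℤ :=
  Matrix.reindex
    ((Equiv.sumCongr finSumFinEquiv (Equiv.refl (Fin 8))).trans finSumFinEquiv)
    ((Equiv.sumCongr finSumFinEquiv (Equiv.refl (Fin 8))).trans finSumFinEquiv)
    (Matrix.fromBlocks (Matrix.fromBlocks latU 0 0 latU) 0 0 latE8)

/-- The determinant of a skew-symmetric matrix over a field of characteristic different from `2`
is a square. -/
theorem Matrix.isSquare_det_of_transpose_eq_neg {K n : Type*} [Field K] [NeZero (2 : K)]
    [Fintype n] [DecidableEq n] (A : Matrix n n K) (hA : Aᵀ = -A) : IsSquare A.det := by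
  have skew (i j : n) : A i j = -A j i := congrFun (congrFun hA j) i
  by_cases h0 : ∀ i j, A i j = 0
  · obtain rfl : A = 0 := by ext i j; exact h0 i j
    cases isEmpty_or_nonempty n <;> simp
  push Not at h0
  obtain ⟨i, j, hij⟩ := h0
  have diag (k : n) : A k k = 0 := by
    have h : 2 * A k k = 0 := by linear_combination skew k k
    exact (mul_eq_zero.mp h).resolve_left two_ne_zero
  have hne : i ≠ j := by rintro rfl; exact hij (diag i)
  let f : Fin 2 → n := ![i, j]
  let p : n → Prop := fun k => k ≠ i ∧ k ≠ j
  let e : Fin 2 ⊕ {k // p k} ≃ n := Equiv.ofBijective (Sum.elim f Subtype.val) (by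
    refine ⟨Function.Injective.sumElim ?_ Subtype.val_injective ?_, ?_⟩
    · intro a b
      fin_cases a <;> fin_cases b <;> simp [f, hne, hne.symm]
    · rintro a ⟨b, hb⟩
      fin_cases a <;> simp [f, hb.1.symm, hb.2.symm]
    · intro k
      by_cases hi : k = i
      · exact ⟨.inl 0, by simp [f, hi]⟩
      by_cases hj : k = j
      · exact ⟨.inl 1, by simp [f, hj]⟩
      exact ⟨.inr ⟨k, hi, hj⟩, rfl⟩)
  let N := A.submatrix e e
  have hN : Nᵀ = -N := by ext a b; exact skew _ _
  have hB : N.toBlocks₁₁ = !![0, A i j; -A i j, 0] := by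
    ext a b
    fin_cases a <;> fin_cases b <;> simp [N, toBlocks₁₁, e, f, diag]
    exacts [rfl, skew j i]
  have hdet : N.toBlocks₁₁.det = A i j * A i j := by
    rw [hB, det_fin_two_of]; ring
  have hunit : IsUnit N.toBlocks₁₁.det := by
    rw [hdet]; exact (mul_ne_zero hij hij).isUnit
  let _ := N.toBlocks₁₁.invertibleOfIsUnitDet hunit
  have h11 : N.toBlocks₁₁ᵀ = -N.toBlocks₁₁ := by ext a b; exact skew _ _
  have h12 : N.toBlocks₁₂ᵀ = -N.toBlocks₂₁ := by ext a b; exact skew _ _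
  have h21 : N.toBlocks₂₁ᵀ = -N.toBlocks₁₂ := by ext a b; exact skew _ _
  have h22 : N.toBlocks₂₂ᵀ = -N.toBlocks₂₂ := by ext a b; exact skew _ _
  have hinv : (-N.toBlocks₁₁)⁻¹ = -N.toBlocks₁₁⁻¹ := by
    apply inv_eq_right_inv
    rw [neg_mul_neg, mul_nonsing_inv _ hunit]
  have hS := isSquare_det_of_transpose_eq_neg
    (N.toBlocks₂₂ - N.toBlocks₂₁ * ⅟N.toBlocks₁₁ * N.toBlocks₁₂) (by
      rw [invOf_eq_nonsing_inv, transpose_sub, transpose_mul, transpose_mul,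
        transpose_nonsing_inv, h11, h12, h21, h22, hinv]
      simp only [Matrix.neg_mul, Matrix.mul_neg, neg_neg, Matrix.mul_assoc]
      abel)
  rw [← det_submatrix_equiv_self e A]
  change IsSquare N.det
  rw [← fromBlocks_toBlocks N, det_fromBlocks₁₁, hdet]
  exact (IsSquare.mul_self _).mul hS
termination_by Fintype.card n
decreasing_by
  exact Fintype.card_subtype_lt (x := i) (by simp)

/-- The inverse of `latE8`. -/
def latE8Inv : Matrix (Fin 8) (Fin 8) ℤ :=
  !![ -4,  -5,  -7, -10,  -8,  -6,  -4,  -2;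
      -5,  -8, -10, -15, -12,  -9,  -6,  -3;
      -7, -10, -14, -20, -16, -12,  -8,  -4;
     -10, -15, -20, -30, -24, -18, -12,  -6;
      -8, -12, -16, -24, -20, -15, -10,  -5;
      -6,  -9, -12, -18, -15, -12,  -8,  -4;
      -4,  -6,  -8, -12, -10,  -8,  -6,  -3;
      -2,  -3,  -4,  -6,  -5,  -4,  -3,  -2]

theorem latE8_mul_latE8Inv : latE8 * latE8Inv = 1 := by
  decide +kernel

theorem isUnit_det_gramUUE8 : IsUnit gramUUE8.det := by
  have hU : latU.det = -1 := by simp [latU, det_fin_two]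
  have hE : IsUnit latE8.det :=
    IsUnit.of_mul_eq_one latE8Inv.det (by rw [← det_mul, latE8_mul_latE8Inv, det_one])
  rw [gramUUE8, det_reindex_self, det_fromBlocks_zero₁₂, det_fromBlocks_zero₁₂, hU]
  rwa [neg_mul_neg, one_mul, one_mul]

theorem gramUUE8_transpose : gramUUE8ᵀ = gramUUE8 := by
  decide +kernel

/-- If `M` is an isometry of a symmetric Gram matrix `G` over `ℤ`, then
`det (1 + M) * det G * det (1 - M)` is a perfect square. -/
theorem isSquare_det_mul_of_isometry {n : Type*} [Fintype n] [DecidableEq n]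
    {G M : Matrix n n ℤ} (hG : Gᵀ = G) (hM : Mᵀ * G * M = G) :
    IsSquare ((1 + M).det * G.det * (1 - M).det) := by
  have hK : (1 + M)ᵀ * G * (1 - M) = Mᵀ * G - G * M := by
    rw [transpose_add, transpose_one, add_mul, one_mul, mul_sub, mul_one, add_mul, hM]
    abel
  have hskew : (Mᵀ * G - G * M)ᵀ = -(Mᵀ * G - G * M) := by
    simp [transpose_sub, transpose_mul, hG]
  have h := isSquare_det_of_transpose_eq_neg ((Mᵀ * G - G * M).map (Int.castRingHom ℚ)) (by
    rw [← transpose_map, hskew]; ext; simp)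
  rw [← RingHom.mapMatrix_apply, ← RingHom.map_det, ← hK, det_mul, det_mul,
    det_transpose] at h
  exact Rat.isSquare_intCast_iff.mp h

/-- The even unimodular lattice `U ⊕ U ⊕ E8` of signature `(2,10)` admits
no isometry whose characteristic polynomial is the 13th cyclotomic polynomial `Φ₁₃`. -/
theorem stmt5 :
    ¬ ∃ M : Matrix (Fin 12) (Fin 12) ℤ,
        Mᵀ * gramUUE8 * M = gramUUE8 ∧ M.charpoly = Polynomial.cyclotomic 13 ℤ := by
  rintro ⟨M, hM, hchar⟩
  have : Fact (Nat.Prime 13) := ⟨by norm_num⟩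
  have h1 : (1 - M).det = 13 := by
    have := M.eval_charpoly 1
    rw [hchar, Polynomial.eval_one_cyclotomic_prime] at this
    simpa using this.symm
  have h2 : (1 + M).det = 1 := by
    have := M.eval_charpoly (-1)
    rw [hchar, Polynomial.cyclotomic_prime, map_neg, map_one,
      show (-1 - M : Matrix (Fin 12) (Fin 12) ℤ) = -(1 + M) by abel, det_neg] at this
    simpa [Polynomial.eval_finsetSum, Finset.sum_range_succ] using this.symm
  have h := isSquare_det_mul_of_isometry gramUUE8_transpose hM
  rw [h1, h2] at h
  rcases Int.isUnit_iff.mp isUnit_det_gramUUE8 with hd | hd <;> rw [hd] at h <;>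
    revert h <;> decide +kernel
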